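/- arXiv:2505.14348 — 2 statements merged into one kernel-verified Lean document; each statement's English description precedes it below -/
import Mathlib

section
/- Composition of nested stronger eventually operators: for every step relation R on a state type Σ, relational conditions Q Rpost : Set (Σ × Σ), all n0 n1 m0 m1 : ℕ, and all states s0 s1 : Σ, if s0 ∈ eventuallyN R n0 {s | s1 ∈ eventuallyN R n1 {s' | (s, s') ∈ Q}}, and for all states s0' s1' with (s0', s1') ∈ Q one has s0' ∈ eventuallyN R m0 {s | s1' ∈ eventuallyN R m1 {s' | (s, s') ∈ Rpost}}, then s0 ∈ eventuallyN R (n0 + m0) {s | s1 ∈ eventuallyN R (n1 + m1) {s' | (s, s') ∈ Rpost}}. -/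
universe u

variable {σ : Type u}

/-- n-fold composition of a step relation. -/
def relIter (R : σ → σ → Prop) : ℕ → σ → σ → Prop
  | 0, s, s' => s = s'
  | n + 1, s, s'' => ∃ s', R s s' ∧ relIter R n s' s''

/-- The `eventually` operator, defined inductively. -/
inductive EventuallyRel (R : σ → σ → Prop) (Q : Set σ) : σ → Prop
  | base {s : σ} : s ∈ Q → EventuallyRel R Q s
  | step {s : σ} : (∃ s', R s s') → (∀ s', R s s' → EventuallyRel R Q s') →
      EventuallyRel R Q s

/-- The set of states from which `Q` eventually holds. -/
def eventually (R : σ → σ → Prop) (Q : Set σ) : Set σ := {s | EventuallyRel R Q s}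

/-- The stronger eventually operator with an explicit number of steps. -/
def eventuallyN (R : σ → σ → Prop) (n : ℕ) (Q : Set σ) : Set σ :=
  {s | (∀ s', relIter R n s s' → s' ∈ Q) ∧
       (∀ l, l < n → ∀ s', relIter R l s s' → ∃ s'', R s' s'')}

/-- Ordinary unary Hoare triple. -/
def ensures (R : σ → σ → Prop) (P Q : Set σ) (F : Set (σ × σ)) : Prop :=
  ∀ s ∈ P, s ∈ eventually R {s' | s' ∈ Q ∧ (s, s') ∈ F}

/-- Stronger unary Hoare triple with a step function. -/
def ensuresN (R : σ → σ → Prop) (fn : σ → ℕ) (P Q : Set σ) (F : Set (σ × σ)) : Prop :=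
  ∀ s ∈ P, s ∈ eventuallyN R (fn s) {s' | s' ∈ Q ∧ (s, s') ∈ F}

/-- Relational Hoare triple. -/
def ensures2 (R : σ → σ → Prop) (fn0 fn1 : σ → ℕ) (P Q : Set (σ × σ))
    (F : Set ((σ × σ) × (σ × σ))) : Prop :=
  ∀ s0 s1, (s0, s1) ∈ P →
    s0 ∈ eventuallyN R (fn0 s0) {s0' | s1 ∈ eventuallyN R (fn1 s1)
      {s1' | (s0', s1') ∈ Q ∧ ((s0, s1), (s0', s1')) ∈ F}}

theorem relIter_add {R : σ → σ → Prop} {n m : ℕ} {s s'' : σ} :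
    relIter R (n + m) s s'' ↔ ∃ s', relIter R n s s' ∧ relIter R m s' s'' := by
  induction n generalizing s with
  | zero => simp [relIter]
  | succ n ih =>
    rw [Nat.add_right_comm]
    simp only [relIter, ih]
    constructor
    · rintro ⟨a, ha, b, hb, hm⟩
      exact ⟨b, ⟨a, ha, hb⟩, hm⟩
    · rintro ⟨b, ⟨a, ha, hb⟩, hm⟩
      exact ⟨a, ha, b, hb, hm⟩

theorem exists_relIter {R : σ → σ → Prop} {n : ℕ} {s : σ}
    (h : ∀ l, l < n → ∀ s', relIter R l s s' → ∃ s'', R s' s'') :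
    ∃ s', relIter R n s s' := by
  induction n with
  | zero => exact ⟨s, rfl⟩
  | succ n ih =>
    obtain ⟨s', hs'⟩ := ih fun l hl => h l (hl.trans n.lt_succ_self)
    obtain ⟨s'', hs''⟩ := h n n.lt_succ_self s' hs'
    exact ⟨s'', relIter_add.2 ⟨s', hs', s'', hs'', rfl⟩⟩

theorem eventuallyN_mono {R : σ → σ → Prop} {n : ℕ} {P Q : Set σ} (h : P ⊆ Q) :
    eventuallyN R n P ⊆ eventuallyN R n Q :=
  fun _ hs => ⟨fun s' hs' => h (hs.1 s' hs'), hs.2⟩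

theorem eventuallyN_add_of_eventuallyN {R : σ → σ → Prop} {n m : ℕ} {Q : Set σ} {s : σ}
    (h : s ∈ eventuallyN R n (eventuallyN R m Q)) : s ∈ eventuallyN R (n + m) Q := by
  refine ⟨fun s'' hs'' => ?_, fun l hl s'' hs'' => ?_⟩
  · obtain ⟨s', hn, hm⟩ := relIter_add.1 hs''
    exact (h.1 s' hn).1 s'' hm
  · obtain hln | hln := lt_or_ge l n
    · exact h.2 l hln s'' hs''
    · obtain ⟨k, rfl⟩ := Nat.exists_eq_add_of_le hln
      obtain ⟨s', hn, hk⟩ := relIter_add.1 hs''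
      exact (h.1 s' hn).2 k (Nat.lt_of_add_lt_add_left hl) s'' hk

/-- Nested `eventuallyN` operators over two independent executions commute. -/
theorem eventuallyN_swap {R : σ → σ → Prop} {n m : ℕ} {B : σ → Set σ} {s t : σ}
    (h : t ∈ eventuallyN R n {t' | s ∈ eventuallyN R m {s' | t' ∈ B s'}}) :
    s ∈ eventuallyN R m {s' | t ∈ eventuallyN R n (B s')} := by
  obtain ⟨t', ht'⟩ := exists_relIter h.2
  exact ⟨fun s' hs' => ⟨fun t'' ht'' => (h.1 t'' ht'').1 s' hs', h.2⟩, (h.1 t' ht').2⟩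

theorem eventuallyN_comp (R : σ → σ → Prop) (Q Rpost : Set (σ × σ))
    (n0 n1 m0 m1 : ℕ) (s0 s1 : σ)
    (h1 : s0 ∈ eventuallyN R n0 {s | s1 ∈ eventuallyN R n1 {s' | (s, s') ∈ Q}})
    (h2 : ∀ s0' s1', (s0', s1') ∈ Q →
      s0' ∈ eventuallyN R m0 {s | s1' ∈ eventuallyN R m1 {s' | (s, s') ∈ Rpost}}) :
    s0 ∈ eventuallyN R (n0 + m0)
      {s | s1 ∈ eventuallyN R (n1 + m1) {s' | (s, s') ∈ Rpost}} := by
  apply eventuallyN_add_of_eventuallyN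
  refine eventuallyN_mono (fun s0' hs1 => ?_) h1
  have hswap : s0' ∈ eventuallyN R m0
      {s | s1 ∈ eventuallyN R n1 (eventuallyN R m1 {s' | (s, s') ∈ Rpost})} :=
    eventuallyN_swap (B := fun s => eventuallyN R m1 {s' | (s, s') ∈ Rpost})
      (eventuallyN_mono (fun s1' hQ => h2 s0' s1' hQ) hs1)
  refine eventuallyN_mono (fun s hs => ?_) hswap
  exact eventuallyN_add_of_eventuallyN hs
end

section
/- Sequencing rule for unary Hoare triples: for every step relation R on a state type Σ, conditions P Rmid Q : Set Σ, and frames F F' : Set (Σ × Σ), if ensures R P Rmid F and ensures R Rmid Q F' hold, then ensures R P Q (F ∘ F') holds, where F ∘ F' := {(s, s'') | ∃ s', (s, s') ∈ F ∧ (s', s'') ∈ F'}. -/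
universe u

variable {σ : Type u}

/-- `EventuallyRel` composes: if `A` is eventually reached and from every state of `A` the set `B`
is eventually reached, then `B` is eventually reached. -/
theorem EventuallyRel.bind {R : σ → σ → Prop} {A B : Set σ} {s : σ} (h : EventuallyRel R A s)
    (hAB : ∀ t ∈ A, EventuallyRel R B t) : EventuallyRel R B s := by
  induction h with
  | base ht => exact hAB _ ht
  | step hex _ ih => exact .step hex ih

theorem EventuallyRel.mono {R : σ → σ → Prop} {A B : Set σ} {s : σ} (h : EventuallyRel R A s)
    (hAB : A ⊆ B) : EventuallyRel R B s :=
  h.bind fun _ ht => .base (hAB ht)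

theorem ensures_seq (R : σ → σ → Prop) (P Rmid Q : Set σ) (F F' : Set (σ × σ))
    (h1 : ensures R P Rmid F) (h2 : ensures R Rmid Q F') :
    ensures R P Q {p | ∃ s', (p.1, s') ∈ F ∧ (s', p.2) ∈ F'} := by
  intro s hs
  refine EventuallyRel.bind (h1 s hs) fun t ht => ?_
  exact EventuallyRel.mono (h2 t ht.1) fun _ hu => ⟨hu.1, t, ht.2, hu.2⟩
end
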